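/- arXiv:1706.02199 — 2 statements merged into one kernel-verified Lean document; each statement's English description precedes it below -/
import Mathlib

section
/- For every ε > 0, ∫_{ℝ^d} ∫_{ℝ^d} |∇( √ρ · χ_ε(· − z) )(x)|² dx dz = ∫_{ℝ^d} |∇√ρ(x)|² dx + ε^{−2} ∫_{ℝ^d} |∇χ(x)|² dx. -/
open MeasureTheory Real

noncomputable section

/-- `ℝ^d` as a Euclidean space. -/
abbrev Euc (d : ℕ) := EuclideanSpace ℝ (Fin d)

/-- Rescaled mollifier `χ_ε(x) = ε^{-d/2} χ(x/ε)`. -/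
def chiE (d : ℕ) (χ : Euc d → ℝ) (ε : ℝ) (x : Euc d) : ℝ :=
  ε ^ (-(d : ℝ) / 2) * χ (ε⁻¹ • x)

/-- Convolution `(ρ ∗ g²)(z) = ∫ ρ(x) g(z - x)² dx`. -/
def convSq (d : ℕ) (ρ : Euc d → ℝ) (g : Euc d → ℝ) (z : Euc d) : ℝ :=
  ∫ x : Euc d, ρ x * (g (z - x)) ^ 2

/-- The Bindini–De Pascale regularization `P_ε` (division by zero is `0` in Lean,
matching the convention that quotients with zero denominator are interpreted as `0`). -/
def Peps (d N : ℕ) (χ : Euc d → ℝ) (ε : ℝ) (ρ : Euc d → ℝ)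
    (P : Measure (Fin N → Euc d)) (X : Fin N → Euc d) : ℝ :=
  ∫ Z : Fin N → Euc d, ∫ Y : Fin N → Euc d,
    (∏ k, ρ (X k) * (chiE d χ ε (X k - Z k)) ^ 2 * (chiE d χ ε (Z k - Y k)) ^ 2
      / convSq d ρ (chiE d χ ε) (Z k)) ∂P

/-- The set `D^c_α` of configurations where all particles are at distance at least `α`. -/
def Dc (d N : ℕ) (α : ℝ) : Set (Fin N → Euc d) :=
  {X | ∀ i j, i ≠ j → α ≤ ‖X i - X j‖}

/-- The gradient of `Φ` with respect to the `j`-th `ℝ^d` coordinate block. -/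
def blockGrad (d N : ℕ) (Φ : (Fin N → Euc d) → ℝ) (j : Fin N) (X : Fin N → Euc d) : Euc d :=
  gradient (fun v => Φ (Function.update X j v)) (X j)

/-- The second derivative `∇_j ∇_k Φ`, as a continuous linear map on `ℝ^d`. -/
def blockGrad2 (d N : ℕ) (Φ : (Fin N → Euc d) → ℝ) (j k : Fin N) (X : Fin N → Euc d) :
    Euc d →L[ℝ] Euc d :=
  fderiv ℝ (fun w => blockGrad d N Φ j (Function.update X k w)) (X k)

/-- Expansion of a double integral of `‖a y • G x + s x • H y‖²` when the cross term vanishes. -/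
theorem integral_integral_norm_sq_smul_add_smul {V E : Type*} [AddCommGroup V]
    [MeasurableSpace V] [MeasurableAdd₂ V] [MeasurableNeg V]
    [NormedAddCommGroup E] [InnerProductSpace ℝ E] [CompleteSpace E]
    {μ : Measure V} [SFinite μ] [μ.IsAddLeftInvariant] [μ.IsNegInvariant]
    {s a : V → ℝ} {G H : V → E} (hs : MemLp s 2 μ) (ha : MemLp a 2 μ)
    (hG : MemLp G 2 μ) (hH : MemLp H 2 μ) (hcross : ∫ y, a y • H y ∂μ = 0) :
    ∫ z, ∫ x, ‖a (x - z) • G x + s x • H (x - z)‖ ^ 2 ∂μ ∂μ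
      = (∫ y, a y ^ 2 ∂μ) * (∫ x, ‖G x‖ ^ 2 ∂μ)
        + (∫ x, s x ^ 2 ∂μ) * ∫ y, ‖H y‖ ^ 2 ∂μ := by
  have hexp (x y : V) : ‖a y • G x + s x • H y‖ ^ 2
      = ‖G x‖ ^ 2 * a y ^ 2 + 2 * inner ℝ (s x • G x) (a y • H y) + s x ^ 2 * ‖H y‖ ^ 2 := by
    rw [norm_add_sq_real, norm_smul, norm_smul, mul_pow, mul_pow]
    simp only [Real.norm_eq_abs, sq_abs, real_inner_smul_left, real_inner_smul_right]
    ring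
  have hs2 := hs.integrable_sq
  have ha2 := ha.integrable_sq
  have hG2 := hG.integrable_norm_pow two_ne_zero
  have hH2 := hH.integrable_norm_pow two_ne_zero
  have hsG : Integrable (fun x => s x • G x) μ := memLp_one_iff_integrable.1 (hG.smul hs)
  have haH : Integrable (fun x => a x • H x) μ := memLp_one_iff_integrable.1 (hH.smul ha)
  have hF : Integrable (fun p : V × V => ‖a p.2 • G p.1 + s p.1 • H p.2‖ ^ 2) (μ.prod μ) := by
    simp only [hexp]
    refine ((hG2.mul_prod ha2).add (Integrable.const_mul ?_ 2)).add (hs2.mul_prod hH2)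
    exact hsG.op_fst_snd (op := fun u v => inner ℝ u v) continuous_inner
      ⟨1, fun u v => by simpa using norm_inner_le_norm (𝕜 := ℝ) u v⟩ haH
  have hshear : MeasurePreserving (fun p : V × V => (p.2, p.2 - p.1)) (μ.prod μ) (μ.prod μ) := by
    have h := (((MeasurePreserving.id μ).prod (Measure.measurePreserving_neg μ)).comp
      (measurePreserving_prod_sub μ μ)).comp
        (Measure.measurePreserving_swap (μ := μ) (ν := μ))
    convert h using 1
    ext p <;> simp
  rw [integral_integral_swap (f := fun z x => ‖a (x - z) • G x + s x • H (x - z)‖ ^ 2)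
    (hshear.integrable_comp_of_integrable hF)]
  have hinner (x : V) : ∫ z, ‖a (x - z) • G x + s x • H (x - z)‖ ^ 2 ∂μ
      = ‖G x‖ ^ 2 * (∫ y, a y ^ 2 ∂μ) + s x ^ 2 * ∫ y, ‖H y‖ ^ 2 ∂μ := by
    rw [integral_sub_left_eq_self (fun y => ‖a y • G x + s x • H y‖ ^ 2) μ x]
    simp only [hexp]
    have hi : Integrable (fun y => 2 * inner ℝ (s x • G x) (a y • H y)) μ :=
      (haH.const_inner _).const_mul 2
    have hsum : Integrable
        (fun y => ‖G x‖ ^ 2 * a y ^ 2 + 2 * inner ℝ (s x • G x) (a y • H y)) μ :=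
      (ha2.const_mul _).add hi
    rw [integral_add hsum (hH2.const_mul _),
      integral_add (ha2.const_mul _) hi, integral_const_mul, integral_const_mul,
      integral_const_mul, integral_inner haH, hcross, inner_zero_right]
    ring
  simp only [hinner]
  rw [integral_add (hG2.mul_const _) (hs2.mul_const _), integral_mul_const, integral_mul_const]
  ring

theorem integral_eq_zero_of_forall_neg {V E : Type*} [AddGroup V] [MeasurableSpace V]
    [MeasurableNeg V] [NormedAddCommGroup E] [NormedSpace ℝ E] {μ : Measure V} [μ.IsNegInvariant]
    {f : V → E} (hf : ∀ x, f (-x) = -f x) : ∫ x, f x ∂μ = 0 := by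
  have : IsAddTorsionFree E := .of_isTorsionFree ℝ E
  rw [← self_eq_neg, ← integral_neg]
  simp_rw [← hf]
  exact (integral_neg_eq_self f μ).symm

section Gradient

variable {F : Type*} [NormedAddCommGroup F] [InnerProductSpace ℝ F] [CompleteSpace F]

theorem gradient_const_mul_comp_smul {f : F → ℝ} (hf : Differentiable ℝ f) (b c : ℝ) (x : F) :
    gradient (fun y => b * f (c • y)) x = (b * c) • gradient f (c • x) := by
  have hd : DifferentiableAt ℝ (fun y => f (c • y)) x := by fun_prop
  have h : fderiv ℝ (fun y => b * f (c • y)) x = (b * c) • fderiv ℝ f (c • x) := by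
    rw [fderiv_const_mul hd, fderiv_comp_smul, smul_smul]
  simp only [gradient, h, map_smulₛₗ, conj_trivial]

theorem gradient_neg_of_even {f : F → ℝ} (hf : Differentiable ℝ f) (heven : ∀ x, f (-x) = f x)
    (x : F) : gradient f (-x) = -gradient f x := by
  have h := gradient_const_mul_comp_smul hf 1 (-1) x
  simp only [neg_smul, one_smul, one_mul, heven] at h
  rw [h, neg_neg]

theorem measurable_gradient [MeasurableSpace F] [BorelSpace F] (f : F → ℝ) :
    Measurable (gradient f) :=
  (InnerProductSpace.toDual ℝ F).symm.continuous.measurable.comp (measurable_fderiv ℝ f)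

theorem continuous_gradient {f : F → ℝ} (hf : ContDiff ℝ 1 f) : Continuous (gradient f) :=
  (InnerProductSpace.toDual ℝ F).symm.continuous.comp (hf.continuous_fderiv one_ne_zero)

theorem hasCompactSupport_gradient {f : F → ℝ} (hf : HasCompactSupport f) :
    HasCompactSupport (gradient f) :=
  (hf.fderiv ℝ).comp_left (g := (InnerProductSpace.toDual ℝ F).symm) (map_zero _)

end Gradient

section Rescaling

variable {d : ℕ} {χ : Euc d → ℝ} {ε : ℝ}

theorem contDiff_chiE {n : WithTop ℕ∞} (hχ : ContDiff ℝ n χ) : ContDiff ℝ n (chiE d χ ε) := by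
  unfold chiE
  fun_prop

theorem hasCompactSupport_chiE (hχ : HasCompactSupport χ) (hε : ε ≠ 0) :
    HasCompactSupport (chiE d χ ε) :=
  (hχ.comp_smul (inv_ne_zero hε)).mul_left

theorem chiE_factor_sq (hε : 0 < ε) : (ε ^ (-(d : ℝ) / 2)) ^ 2 * ε ^ d = 1 := by
  rw [← Real.rpow_natCast, ← Real.rpow_natCast, ← Real.rpow_mul hε.le, ← Real.rpow_add hε]
  convert Real.rpow_zero ε using 2
  push_cast
  ring

theorem integral_factor_sq_mul_comp_inv_smul (hε : 0 < ε) (f : Euc d → ℝ) :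
    ∫ x, (ε ^ (-(d : ℝ) / 2)) ^ 2 * f (ε⁻¹ • x) = ∫ x, f x := by
  rw [integral_const_mul, Measure.integral_comp_inv_smul_of_nonneg volume f hε.le,
    finrank_euclideanSpace_fin, smul_eq_mul, ← mul_assoc, chiE_factor_sq hε, one_mul]

theorem integral_chiE_sq (hε : 0 < ε) : ∫ x, chiE d χ ε x ^ 2 = ∫ x, χ x ^ 2 := by
  simp only [chiE, mul_pow]
  exact integral_factor_sq_mul_comp_inv_smul hε fun x => χ x ^ 2

theorem integral_norm_gradient_chiE_sq (hχ : Differentiable ℝ χ) (hε : 0 < ε) :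
    ∫ x, ‖gradient (chiE d χ ε) x‖ ^ 2 = ε⁻¹ ^ 2 * ∫ x, ‖gradient χ x‖ ^ 2 := by
  have h (x : Euc d) : ‖gradient (chiE d χ ε) x‖ ^ 2
      = ε⁻¹ ^ 2 * ((ε ^ (-(d : ℝ) / 2)) ^ 2 * ‖gradient χ (ε⁻¹ • x)‖ ^ 2) := by
    unfold chiE
    rw [gradient_const_mul_comp_smul hχ, norm_smul, mul_pow, Real.norm_eq_abs, sq_abs]
    ring
  simp only [h]
  rw [integral_const_mul, integral_factor_sq_mul_comp_inv_smul hε fun x => ‖gradient χ x‖ ^ 2]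

end Rescaling

/-- kinetic energy identity
`∫∫ |∇(√ρ · χ_ε(· − z))(x)|² dx dz = ∫ |∇√ρ|² + ε⁻² ∫ |∇χ|²`,
where `∇(√ρ · χ_ε(· − z))(x) = χ_ε(x − z) ∇√ρ(x) + √ρ(x) ∇χ_ε(x − z)` a.e. -/
theorem kinetic_energy_identity
    (d : ℕ) (hd : 1 ≤ d)
    (χ : Euc d → ℝ) (hχ_smooth : ContDiff ℝ (⊤ : ℕ∞) χ)
    (hχ_supp : Function.support χ ⊆ Metric.closedBall 0 1)
    (hχ_radial : ∀ x y : Euc d, ‖x‖ = ‖y‖ → χ x = χ y)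
    (hχ_norm : ∫ x : Euc d, (χ x) ^ 2 = 1)
    (ε : ℝ) (hε : 0 < ε)
    (ρ : Euc d → ℝ) (hρ_nonneg : ∀ x, 0 ≤ ρ x)
    (hρ_int : Integrable ρ) (hρ_mass : ∫ x : Euc d, ρ x = 1)
    (hsqrt_diff : ∀ᵐ x : Euc d, DifferentiableAt ℝ (fun t => Real.sqrt (ρ t)) x)
    (hsqrt_gradL2 :
      Integrable (fun x : Euc d => ‖gradient (fun t => Real.sqrt (ρ t)) x‖ ^ 2)) :
    ∫ z : Euc d, ∫ x : Euc d,
        ‖chiE d χ ε (x - z) • gradient (fun t => Real.sqrt (ρ t)) x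
          + Real.sqrt (ρ x) • gradient (chiE d χ ε) (x - z)‖ ^ 2
      = (∫ x : Euc d, ‖gradient (fun t => Real.sqrt (ρ t)) x‖ ^ 2)
        + ε⁻¹ ^ 2 * ∫ x : Euc d, ‖gradient χ x‖ ^ 2 := by
  have hχ1 : ContDiff ℝ 1 χ := hχ_smooth.of_le (by exact_mod_cast le_top)
  have hχ_compact : HasCompactSupport χ :=
    HasCompactSupport.of_support_subset_isCompact (isCompact_closedBall 0 1) hχ_supp
  have hc1 : ContDiff ℝ 1 (chiE d χ ε) := contDiff_chiE hχ1
  have hc_compact : HasCompactSupport (chiE d χ ε) := hasCompactSupport_chiE hχ_compact hε.ne'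
  have hc_even (x : Euc d) : chiE d χ ε (-x) = chiE d χ ε x := by
    simp only [chiE]
    rw [hχ_radial (ε⁻¹ • -x) (ε⁻¹ • x) (by simp)]
  have hcross : ∫ y, chiE d χ ε y • gradient (chiE d χ ε) y = 0 :=
    integral_eq_zero_of_forall_neg fun x => by
      rw [hc_even, gradient_neg_of_even (hc1.differentiable one_ne_zero) hc_even, smul_neg]
  have hs : MemLp (fun x => √(ρ x)) 2 := by
    refine (memLp_two_iff_integrable_sq
      (Real.continuous_sqrt.comp_aestronglyMeasurable hρ_int.aestronglyMeasurable)).2 ?_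
    simpa only [Real.sq_sqrt (hρ_nonneg _)] using hρ_int
  have hG : MemLp (gradient fun t => √(ρ t)) 2 :=
    (memLp_two_iff_integrable_sq_norm (measurable_gradient _).aestronglyMeasurable).2 hsqrt_gradL2
  rw [integral_integral_norm_sq_smul_add_smul hs
    (hc1.continuous.memLp_of_hasCompactSupport hc_compact) hG
    ((continuous_gradient hc1).memLp_of_hasCompactSupport
      (hasCompactSupport_gradient hc_compact)) hcross,
    integral_chiE_sq hε, hχ_norm, integral_norm_gradient_chiE_sq
      (hχ1.differentiable one_ne_zero) hε]
  simp only [Real.sq_sqrt (hρ_nonneg _), hρ_mass, one_mul]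
end
end

section
/- (Weak convergence.) Suppose P is supported in D^c_α for some α > 0 and ρ_P is differentiable almost everywhere with ∇ρ_P ∈ L¹(ℝ^d). Then P_ε converges weakly to P as ε → 0⁺: for every bounded continuous function Φ : (ℝ^d)^N → ℝ, ∫_{(ℝ^d)^N} Φ(X) P_ε(X) dX → ∫_{(ℝ^d)^N} Φ dP as ε → 0⁺. -/
open MeasureTheory Real

noncomputable section

/-- Tonelli's theorem for products of functions of the individual coordinates. -/
theorem lintegral_fin_prod_eq_prod {n : ℕ} {E : Type*} [MeasureSpace E]
    [SigmaFinite (volume : Measure E)] (f : Fin n → E → ENNReal) (hf : ∀ i, Measurable (f i)) :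
    ∫⁻ x : Fin n → E, ∏ i, f i (x i) = ∏ i, ∫⁻ x, f i x := by
  induction n with
  | zero => simp [volume_pi]
  | succ n ih =>
    rw [volume_pi, ← (measurePreserving_piFinSuccAbove
      (fun _ : Fin (n + 1) => (volume : Measure E)) 0).symm.lintegral_comp_emb
        (MeasurableEquiv.measurableEmbedding _)]
    simp_rw [MeasurableEquiv.piFinSuccAbove_symm_apply, Fin.insertNthEquiv,
      Fin.prod_univ_succ, Fin.insertNth_zero, Equiv.coe_fn_mk, Fin.cons_succ, Fin.cons_zero]
    rw [← ih (fun i => f i.succ) (fun i => hf _), ← lintegral_prod_mul (hf 0).aemeasurable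
      (Finset.measurable_prod _ fun i _ =>
        (hf i.succ).comp (measurable_pi_apply i)).aemeasurable]
    rfl

/-- The one-particle factor of the Bindini–De Pascale kernel for a mollifier `g`. -/
def bdpFactor (d : ℕ) (ρ g : Euc d → ℝ) (x z y : Euc d) : ℝ :=
  ρ x * g (x - z) ^ 2 * g (z - y) ^ 2 / convSq d ρ g z

section Factor

variable {d : ℕ} {ρ g : Euc d → ℝ}

theorem convSq_nonneg (hρ : ∀ x, 0 ≤ ρ x) (z : Euc d) : 0 ≤ convSq d ρ g z :=
  integral_nonneg fun x => mul_nonneg (hρ x) (sq_nonneg _)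

theorem bdpFactor_nonneg (hρ : ∀ x, 0 ≤ ρ x) (x z y : Euc d) : 0 ≤ bdpFactor d ρ g x z y :=
  div_nonneg (mul_nonneg (mul_nonneg (hρ x) (sq_nonneg _)) (sq_nonneg _)) (convSq_nonneg hρ z)

theorem measurable_convSq (hρ : Measurable ρ) (hg : Measurable g) :
    Measurable (convSq d ρ g) := by
  have h : Measurable (fun p : Euc d × Euc d => ρ p.2 * g (p.1 - p.2) ^ 2) := by fun_prop
  exact h.stronglyMeasurable.integral_prod_right.measurable

theorem measurable_bdpFactor (hρ : Measurable ρ) (hg : Measurable g) :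
    Measurable (fun p : Euc d × Euc d × Euc d => bdpFactor d ρ g p.1 p.2.1 p.2.2) := by
  have := measurable_convSq hρ hg
  unfold bdpFactor
  fun_prop

theorem lintegral_mul_sq_eq_convSq (hρ0 : ∀ x, 0 ≤ ρ x) (hρi : Integrable ρ)
    (hg : Measurable g) {C : ℝ} (hC : ∀ x, ‖g x‖ ≤ C) (z : Euc d) :
    ∫⁻ x, ENNReal.ofReal (ρ x * g (z - x) ^ 2) = ENNReal.ofReal (convSq d ρ g z) := by
  rw [convSq, ofReal_integral_eq_lintegral_ofReal _
    (.of_forall fun x => mul_nonneg (hρ0 x) (sq_nonneg _))]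
  refine hρi.mul_bdd (c := C ^ 2)
    (Measurable.aestronglyMeasurable (by fun_prop)) (.of_forall fun x => ?_)
  rw [norm_pow]
  gcongr
  exact hC _

theorem lintegral_bdpFactor (hρ0 : ∀ x, 0 ≤ ρ x) (hρm : Measurable ρ) (hρi : Integrable ρ)
    (hg : Measurable g) (hge : ∀ x, g (-x) = g x) {C : ℝ} (hC : ∀ x, ‖g x‖ ≤ C) (z y : Euc d) :
    ∫⁻ x, ENNReal.ofReal (bdpFactor d ρ g x z y)
      = if convSq d ρ g z = 0 then 0 else ENNReal.ofReal (g (z - y) ^ 2) := by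
  split_ifs with h
  · simp [bdpFactor, h]
  · have hpos : 0 < convSq d ρ g z := lt_of_le_of_ne (convSq_nonneg hρ0 z) (Ne.symm h)
    have : ∀ x, ENNReal.ofReal (bdpFactor d ρ g x z y)
        = ENNReal.ofReal (ρ x * g (z - x) ^ 2)
          * ENNReal.ofReal (g (z - y) ^ 2 / convSq d ρ g z) := fun x => by
      rw [← ENNReal.ofReal_mul (mul_nonneg (hρ0 x) (sq_nonneg _)), ← neg_sub x z, hge, bdpFactor,
        mul_div_assoc]
    simp_rw [this]
    rw [lintegral_mul_const _ (by fun_prop), lintegral_mul_sq_eq_convSq hρ0 hρi hg hC,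
      ← ENNReal.ofReal_mul hpos.le, mul_div_cancel₀ _ h]

/-- For `ρ`-almost every `y` the factor has total mass one. -/
theorem ae_lintegral_lintegral_bdpFactor (hρ0 : ∀ x, 0 ≤ ρ x) (hρm : Measurable ρ)
    (hρi : Integrable ρ) (hg : Measurable g) (hge : ∀ x, g (-x) = g x) {C : ℝ}
    (hC : ∀ x, ‖g x‖ ≤ C) (hg1 : ∫⁻ x, ENNReal.ofReal (g x ^ 2) = 1) :
    ∀ᵐ y ∂(volume.withDensity fun x => ENNReal.ofReal (ρ x)),
      ∫⁻ z, ∫⁻ x, ENNReal.ofReal (bdpFactor d ρ g x z y) = 1 := by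
  set c := convSq d ρ g with hc
  have hcm : Measurable c := measurable_convSq hρm hg
  have hS : MeasurableSet {p : Euc d × Euc d | c p.2 = 0} :=
    (hcm.comp measurable_snd) (measurableSet_singleton 0)
  let F : Euc d → Euc d → ENNReal :=
    fun y z => if c z = 0 then ENNReal.ofReal (g (z - y) ^ 2) else 0
  have hF : Measurable (fun p : Euc d × Euc d => F p.1 p.2) :=
    Measurable.ite hS (by fun_prop) measurable_const
  have hzero : ∫⁻ y, (∫⁻ z, F y z) ∂volume.withDensity (fun x => ENNReal.ofReal (ρ x)) = 0 := by
    rw [lintegral_withDensity_eq_lintegral_mul _ (by fun_prop) hF.lintegral_prod_right']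
    simp only [Pi.mul_apply]
    have : ∀ y, ENNReal.ofReal (ρ y) * ∫⁻ z, F y z = ∫⁻ z, ENNReal.ofReal (ρ y) * F y z :=
      fun y => (lintegral_const_mul _ (hF.comp measurable_prodMk_left)).symm
    simp_rw [this]
    rw [lintegral_lintegral_swap (Measurable.aemeasurable (by fun_prop))]
    rw [← lintegral_zero (α := Euc d) (μ := volume)]
    refine lintegral_congr fun z => ?_
    by_cases hz : c z = 0
    · simp only [F, hz, if_true]
      simp_rw [← ENNReal.ofReal_mul (hρ0 _)]
      rw [lintegral_mul_sq_eq_convSq hρ0 hρi hg hC, ← hc, hz, ENNReal.ofReal_zero]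
    · simp [F, hz]
  rw [lintegral_eq_zero_iff hF.lintegral_prod_right'] at hzero
  filter_upwards [hzero] with y hy
  simp_rw [lintegral_bdpFactor hρ0 hρm hρi hg hge hC]
  have hsum : ∫⁻ z, ((if c z = 0 then 0 else ENNReal.ofReal (g (z - y) ^ 2)) + F y z) = 1 := by
    rw [← hg1, ← lintegral_sub_right_eq_self (fun x => ENNReal.ofReal (g x ^ 2)) y]
    refine lintegral_congr fun z => ?_
    by_cases hz : c z = 0 <;> simp [F, hz]
  have hFy : Measurable (F y) := hF.comp measurable_prodMk_left
  rwa [lintegral_add_right _ hFy, show ∫⁻ z, F y z = 0 from hy, add_zero] at hsum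

/-- The factor vanishes unless `x` and `y` are within twice the range of the mollifier. -/
theorem dist_le_of_bdpFactor_ne_zero {r : ℝ} (hr : ∀ x, g x ≠ 0 → ‖x‖ ≤ r) {x z y : Euc d}
    (h : bdpFactor d ρ g x z y ≠ 0) : dist x y ≤ 2 * r := by
  have h1 : g (x - z) ≠ 0 := fun h0 => h (by simp [bdpFactor, h0])
  have h2 : g (z - y) ≠ 0 := fun h0 => h (by simp [bdpFactor, h0])
  have := dist_triangle x z y
  have h3 := hr _ h1
  have h4 := hr _ h2
  rw [← dist_eq_norm] at h3 h4
  linarith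

end Factor

section Kernel

variable {d N : ℕ} {ρ g : Euc d → ℝ}

/-- The `N`-particle kernel at `((X, Z), Y)`. -/
def bdpKernel (d N : ℕ) (ρ g : Euc d → ℝ)
    (p : ((Fin N → Euc d) × (Fin N → Euc d)) × (Fin N → Euc d)) : ℝ :=
  ∏ k, bdpFactor d ρ g (p.1.1 k) (p.1.2 k) (p.2 k)

theorem bdpKernel_nonneg (hρ : ∀ x, 0 ≤ ρ x)
    (p : ((Fin N → Euc d) × (Fin N → Euc d)) × (Fin N → Euc d)) : 0 ≤ bdpKernel d N ρ g p :=
  Finset.prod_nonneg fun _ _ => bdpFactor_nonneg hρ _ _ _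

theorem measurable_bdpKernel (hρ : Measurable ρ) (hg : Measurable g) :
    Measurable (bdpKernel d N ρ g) := by
  refine Finset.measurable_prod _ fun k _ => ?_
  exact (measurable_bdpFactor hρ hg).comp
    (g := fun p : Euc d × Euc d × Euc d => bdpFactor d ρ g p.1 p.2.1 p.2.2)
    (f := fun p : ((Fin N → Euc d) × (Fin N → Euc d)) × (Fin N → Euc d) =>
      (p.1.1 k, p.1.2 k, p.2 k)) (by fun_prop)

theorem lintegral_bdpKernel (hρ0 : ∀ x, 0 ≤ ρ x) (hρm : Measurable ρ) (hg : Measurable g)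
    {Y : Fin N → Euc d}
    (hY : ∀ k, ∫⁻ z, ∫⁻ x, ENNReal.ofReal (bdpFactor d ρ g x z (Y k)) = 1) :
    ∫⁻ W : (Fin N → Euc d) × (Fin N → Euc d), ENNReal.ofReal (bdpKernel d N ρ g (W, Y)) = 1 := by
  have hm : ∀ y, Measurable (fun p : Euc d × Euc d => ENNReal.ofReal (bdpFactor d ρ g p.2 p.1 y)) :=
    fun y => ((measurable_bdpFactor hρm hg).comp
      (f := fun p : Euc d × Euc d => (p.2, p.1, y)) (by fun_prop)).ennreal_ofReal
  have hK : Measurable (fun W : (Fin N → Euc d) × (Fin N → Euc d) =>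
      ENNReal.ofReal (bdpKernel d N ρ g (W, Y))) :=
    ((measurable_bdpKernel hρm hg).comp measurable_prodMk_right).ennreal_ofReal
  rw [Measure.volume_eq_prod, lintegral_prod_symm' _ hK]
  simp only [bdpKernel]
  simp_rw [ENNReal.ofReal_prod_of_nonneg fun k _ => bdpFactor_nonneg hρ0 _ _ _]
  have h1 : ∀ Z : Fin N → Euc d,
      ∫⁻ X : Fin N → Euc d, ∏ k, ENNReal.ofReal (bdpFactor d ρ g (X k) (Z k) (Y k))
        = ∏ k, ∫⁻ x, ENNReal.ofReal (bdpFactor d ρ g x (Z k) (Y k)) := fun Z =>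
    lintegral_fin_prod_eq_prod (fun k x => ENNReal.ofReal (bdpFactor d ρ g x (Z k) (Y k)))
      fun k => (hm (Y k)).comp measurable_prodMk_left
  simp_rw [h1]
  rw [lintegral_fin_prod_eq_prod
    (fun k z => ∫⁻ x, ENNReal.ofReal (bdpFactor d ρ g x z (Y k)))
    fun k => (hm (Y k)).lintegral_prod_right']
  simp [hY]

instance : SFinite ((volume : Measure (Fin N → Euc d)).prod (volume : Measure (Fin N → Euc d))) :=
  Measure.prod.instSFinite

variable {P : Measure (Fin N → Euc d)} [IsProbabilityMeasure P]

theorem integrable_bdpKernel (hρ0 : ∀ x, 0 ≤ ρ x) (hρm : Measurable ρ) (hg : Measurable g)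
    (hP : ∀ᵐ Y ∂P, ∫⁻ W : (Fin N → Euc d) × (Fin N → Euc d),
      ENNReal.ofReal (bdpKernel d N ρ g (W, Y)) = 1) :
    Integrable (bdpKernel d N ρ g) ((volume.prod volume).prod P) := by
  have hm := measurable_bdpKernel (N := N) hρm hg
  refine ⟨hm.aestronglyMeasurable, ?_⟩
  rw [hasFiniteIntegral_iff_ofReal (.of_forall (bdpKernel_nonneg hρ0)),
    lintegral_prod_symm' _ hm.ennreal_ofReal]
  simp [← Measure.volume_eq_prod, lintegral_congr_ae hP]

/-- The regularization tested against a bounded function, with the integral over `P` outermost. -/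
theorem integral_mul_integral_bdpKernel (hρ0 : ∀ x, 0 ≤ ρ x) (hρm : Measurable ρ)
    (hg : Measurable g)
    (hP : ∀ᵐ Y ∂P, ∫⁻ W : (Fin N → Euc d) × (Fin N → Euc d),
      ENNReal.ofReal (bdpKernel d N ρ g (W, Y)) = 1)
    {Φ : (Fin N → Euc d) → ℝ} (hΦ : Measurable Φ) {M : ℝ} (hM : ∀ X, |Φ X| ≤ M) :
    Integrable (fun Y => ∫ W : (Fin N → Euc d) × (Fin N → Euc d),
        Φ W.1 * bdpKernel d N ρ g (W, Y)) P ∧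
    ∫ X, Φ X * ∫ Z, ∫ Y, bdpKernel d N ρ g ((X, Z), Y) ∂P
      = ∫ Y, (∫ W : (Fin N → Euc d) × (Fin N → Euc d), Φ W.1 * bdpKernel d N ρ g (W, Y)) ∂P := by
  have hint : Integrable (fun p => Φ p.1.1 * bdpKernel d N ρ g p)
      ((volume.prod volume).prod P) :=
    (integrable_bdpKernel hρ0 hρm hg hP).bdd_mul (c := M)
      (Measurable.aestronglyMeasurable (by fun_prop)) (.of_forall fun p => hM _)
  refine ⟨hint.integral_prod_right, ?_⟩
  rw [Measure.volume_eq_prod, ← integral_prod_symm _ hint, integral_prod _ hint,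
    integral_prod _ hint.integral_prod_left]
  simp_rw [integral_const_mul]

/-- Averaging against a kernel of unit mass localized near `Y` approximates evaluation at `Y`. -/
theorem abs_integral_mul_bdpKernel_sub_le (hρ0 : ∀ x, 0 ≤ ρ x) (hρm : Measurable ρ)
    (hg : Measurable g) {r : ℝ} (hr0 : 0 ≤ r) (hr : ∀ x, g x ≠ 0 → ‖x‖ ≤ r)
    {Y : Fin N → Euc d}
    (hY : ∫⁻ W : (Fin N → Euc d) × (Fin N → Euc d),
      ENNReal.ofReal (bdpKernel d N ρ g (W, Y)) = 1)
    {Φ : (Fin N → Euc d) → ℝ} (hΦ : Measurable Φ) {M : ℝ} (hM : ∀ X, |Φ X| ≤ M) {η : ℝ}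
    (hη : ∀ X, dist X Y ≤ 2 * r → |Φ X - Φ Y| ≤ η) :
    |(∫ W : (Fin N → Euc d) × (Fin N → Euc d), Φ W.1 * bdpKernel d N ρ g (W, Y)) - Φ Y| ≤ η := by
  have hm : Measurable (fun W => bdpKernel d N ρ g (W, Y)) :=
    (measurable_bdpKernel hρm hg).comp measurable_prodMk_right
  have h0 : ∀ W, 0 ≤ bdpKernel d N ρ g (W, Y) := fun W => bdpKernel_nonneg hρ0 _
  have hi : Integrable (fun W : (Fin N → Euc d) × (Fin N → Euc d) => bdpKernel d N ρ g (W, Y)) :=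
    ⟨hm.aestronglyMeasurable, by
      rw [hasFiniteIntegral_iff_ofReal (.of_forall h0), hY]; exact ENNReal.one_lt_top⟩
  have h1 : ∫ W : (Fin N → Euc d) × (Fin N → Euc d), bdpKernel d N ρ g (W, Y) = 1 := by
    rw [integral_eq_lintegral_of_nonneg_ae (.of_forall h0) hm.aestronglyMeasurable, hY]
    simp
  have hΦi : Integrable (fun W : (Fin N → Euc d) × (Fin N → Euc d) =>
      Φ W.1 * bdpKernel d N ρ g (W, Y)) :=
    hi.bdd_mul (c := M)
      (Measurable.aestronglyMeasurable (by fun_prop)) (.of_forall fun p => hM _)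
  have h2 : (∫ W : (Fin N → Euc d) × (Fin N → Euc d), Φ W.1 * bdpKernel d N ρ g (W, Y)) - Φ Y
      = ∫ W : (Fin N → Euc d) × (Fin N → Euc d),
        (Φ W.1 * bdpKernel d N ρ g (W, Y) - Φ Y * bdpKernel d N ρ g (W, Y)) := by
    rw [integral_sub hΦi (hi.const_mul _), integral_const_mul, h1, mul_one]
  rw [h2, ← Real.norm_eq_abs]
  calc _ ≤ ∫ W : (Fin N → Euc d) × (Fin N → Euc d), η * bdpKernel d N ρ g (W, Y) := by
        refine norm_integral_le_of_norm_le (hi.const_mul η) (.of_forall fun W => ?_)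
        by_cases hW : bdpKernel d N ρ g (W, Y) = 0
        · simp [hW]
        · rw [← sub_mul, norm_mul, Real.norm_of_nonneg (h0 W)]
          refine mul_le_mul_of_nonneg_right (hη _ ?_) (h0 W)
          rw [dist_pi_le_iff (by positivity)]
          exact fun k => dist_le_of_bdpFactor_ne_zero hr
            (Finset.prod_ne_zero_iff.mp hW k (Finset.mem_univ k))
    _ = η := by rw [integral_const_mul, h1, mul_one]

end Kernel

theorem lintegral_chiE_sq {d : ℕ} {χ : Euc d → ℝ} (hχ : ∫ x, χ x ^ 2 = 1) {ε : ℝ} (hε : 0 < ε) :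
    ∫⁻ x, ENNReal.ofReal (chiE d χ ε x ^ 2) = 1 := by
  have hi : Integrable (fun x => χ x ^ 2) := by
    by_contra h
    rw [integral_undef h] at hχ
    exact zero_ne_one hχ
  have hsq : ∀ x, chiE d χ ε x ^ 2 = (ε ^ d)⁻¹ * χ (ε⁻¹ • x) ^ 2 := fun x => by
    have h : (ε ^ (-(d : ℝ) / 2)) ^ 2 = (ε ^ d)⁻¹ := by
      rw [← Real.rpow_mul_natCast hε.le, Nat.cast_ofNat, div_mul_cancel₀ _ two_ne_zero,
        Real.rpow_neg hε.le, Real.rpow_natCast]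
    rw [chiE, mul_pow, h]
  have hi' : Integrable (fun x => chiE d χ ε x ^ 2) := by
    simp_rw [hsq]
    exact (hi.comp_smul (inv_ne_zero hε.ne')).const_mul _
  rw [← ofReal_integral_eq_lintegral_ofReal hi' (.of_forall fun x => sq_nonneg _)]
  simp_rw [hsq]
  rw [integral_const_mul, Measure.integral_comp_inv_smul_of_nonneg _ (fun x => χ x ^ 2) hε.le, hχ,
    finrank_euclideanSpace_fin, smul_eq_mul, mul_one, inv_mul_cancel₀ (by positivity),
    ENNReal.ofReal_one]

theorem norm_le_of_chiE_ne_zero {d : ℕ} {χ : Euc d → ℝ}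
    (hχ : Function.support χ ⊆ Metric.closedBall 0 1) {ε : ℝ} (hε : 0 < ε) {x : Euc d}
    (hx : chiE d χ ε x ≠ 0) : ‖x‖ ≤ ε := by
  have h : ε⁻¹ • x ∈ Metric.closedBall (0 : Euc d) 1 := hχ (right_ne_zero_of_mul hx)
  rwa [mem_closedBall_zero_iff, norm_smul, norm_inv, Real.norm_of_nonneg hε.le,
    inv_mul_le_iff₀ hε, mul_one] at h

theorem exists_norm_chiE_le {d : ℕ} {χ : Euc d → ℝ} (hχc : Continuous χ)
    (hχ : Function.support χ ⊆ Metric.closedBall 0 1) (ε : ℝ) : ∃ C, ∀ x, ‖chiE d χ ε x‖ ≤ C := by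
  obtain ⟨C, hC⟩ := (HasCompactSupport.of_support_subset_isCompact
    (isCompact_closedBall (0 : Euc d) 1) hχ).exists_bound_of_continuous hχc
  refine ⟨‖ε ^ (-(d : ℝ) / 2)‖ * C, fun x => ?_⟩
  rw [chiE, norm_mul]
  gcongr
  exact hC _

theorem map_eval_eq_of_symm {N : ℕ} {E : Type*} [MeasurableSpace E] {P : Measure (Fin N → E)}
    (hP : ∀ σ : Equiv.Perm (Fin N), P.map (fun X => X ∘ σ) = P) (i k : Fin N) :
    P.map (fun X => X k) = P.map (fun X => X i) := by
  have hm : Measurable (fun X : Fin N → E => X ∘ Equiv.swap i k) :=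
    measurable_pi_lambda _ fun j => measurable_pi_apply _
  conv_rhs => rw [← hP (Equiv.swap i k), Measure.map_map (measurable_pi_apply i) hm]
  congr 1
  ext X
  simp

/-- weak convergence: `P_ε ⇀ P` as `ε → 0⁺`, tested against any
bounded continuous function `Φ`. -/
theorem bindiniDePascale_weak_convergence
    (d N : ℕ) (hd : 1 ≤ d) (hN : 2 ≤ N)
    (χ : Euc d → ℝ) (hχ_smooth : ContDiff ℝ (⊤ : ℕ∞) χ)
    (hχ_supp : Function.support χ ⊆ Metric.closedBall 0 1)
    (hχ_radial : ∀ x y : Euc d, ‖x‖ = ‖y‖ → χ x = χ y)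
    (hχ_norm : ∫ x : Euc d, (χ x) ^ 2 = 1)
    (α : ℝ) (hα : 0 < α)
    (P : Measure (Fin N → Euc d)) [IsProbabilityMeasure P]
    (hP_symm : ∀ σ : Equiv.Perm (Fin N), P.map (fun X => X ∘ σ) = P)
    (ρ : Euc d → ℝ) (hρ_nonneg : ∀ x, 0 ≤ ρ x) (hρ_meas : Measurable ρ)
    (hP_marginal : P.map (fun X => X (⟨0, by omega⟩ : Fin N))
      = volume.withDensity (fun x => ENNReal.ofReal (ρ x)))
    (hP_supp : ∀ᵐ Y ∂P, Y ∈ Dc d N α)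
    (hρ_diff : ∀ᵐ x : Euc d, DifferentiableAt ℝ ρ x)
    (hρ_gradL1 : Integrable (fun x : Euc d => gradient ρ x))
    (Φ : (Fin N → Euc d) → ℝ) (hΦ_cont : Continuous Φ)
    (M : ℝ) (hΦ_bdd : ∀ X, |Φ X| ≤ M) :
    Filter.Tendsto (fun ε : ℝ => ∫ X : Fin N → Euc d, Φ X * Peps d N χ ε ρ P X)
      (nhdsWithin 0 (Set.Ioi 0)) (nhds (∫ X, Φ X ∂P)) := by
  set μ : Measure (Euc d) := volume.withDensity (fun x => ENNReal.ofReal (ρ x)) with hμ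
  have hmarg : ∀ k : Fin N, P.map (fun X => X k) = μ := fun k =>
    (map_eval_eq_of_symm hP_symm _ k).trans hP_marginal
  have hρi : Integrable ρ := by
    refine ⟨hρ_meas.aestronglyMeasurable, ?_⟩
    rw [hasFiniteIntegral_iff_ofReal (.of_forall hρ_nonneg), ← setLIntegral_univ,
      ← withDensity_apply _ MeasurableSet.univ, ← hμ, ← hP_marginal]
    exact measure_lt_top _ _
  have hgm : ∀ ε, Measurable (chiE d χ ε) := fun ε => by
    have := hχ_smooth.continuous.measurable
    unfold chiE
    fun_prop
  have hge : ∀ ε x, chiE d χ ε (-x) = chiE d χ ε x := fun ε x => by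
    rw [chiE, chiE, hχ_radial (ε⁻¹ • -x) (ε⁻¹ • x) (by simp)]
  have hmass : ∀ ε : ℝ, 0 < ε → ∀ᵐ Y ∂P, ∫⁻ W : (Fin N → Euc d) × (Fin N → Euc d),
      ENNReal.ofReal (bdpKernel d N ρ (chiE d χ ε) (W, Y)) = 1 := fun ε hε => by
    obtain ⟨C, hC⟩ := exists_norm_chiE_le hχ_smooth.continuous hχ_supp ε
    have hae := ae_lintegral_lintegral_bdpFactor hρ_nonneg hρ_meas hρi (hgm ε) (hge ε) hC
      (lintegral_chiE_sq hχ_norm hε)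
    have : ∀ᵐ Y ∂P, ∀ k, ∫⁻ z, ∫⁻ x,
        ENNReal.ofReal (bdpFactor d ρ (chiE d χ ε) x z (Y k)) = 1 :=
      ae_all_iff.mpr fun k => ae_of_ae_map (measurable_pi_apply k).aemeasurable
        (by rw [hmarg k]; exact hae)
    filter_upwards [this] with Y hY
    exact lintegral_bdpKernel hρ_nonneg hρ_meas (hgm ε) hY
  refine Filter.tendsto_of_seq_tendsto fun u hu => ?_
  obtain ⟨hu0, hupos⟩ := tendsto_nhdsWithin_iff.mp hu
  have hmass' : ∀ᵐ Y ∂P, ∀ n, 0 < u n → ∫⁻ W : (Fin N → Euc d) × (Fin N → Euc d),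
      ENNReal.ofReal (bdpKernel d N ρ (chiE d χ (u n)) (W, Y)) = 1 :=
    ae_all_iff.mpr fun n => by
      by_cases h : 0 < u n
      · filter_upwards [hmass _ h] with Y hY _ using hY
      · simp [h]
  have hclose : ∀ ε : ℝ, 0 < ε → ∀ Y : Fin N → Euc d,
      ∫⁻ W : (Fin N → Euc d) × (Fin N → Euc d),
        ENNReal.ofReal (bdpKernel d N ρ (chiE d χ ε) (W, Y)) = 1 → ∀ η,
      (∀ X, dist X Y ≤ 2 * ε → |Φ X - Φ Y| ≤ η) →
      |(∫ W : (Fin N → Euc d) × (Fin N → Euc d),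
        Φ W.1 * bdpKernel d N ρ (chiE d χ ε) (W, Y)) - Φ Y| ≤ η := fun ε hε Y hY η hη =>
    abs_integral_mul_bdpKernel_sub_le hρ_nonneg hρ_meas (hgm ε) hε.le
      (fun x => norm_le_of_chiE_ne_zero hχ_supp hε) hY hΦ_cont.measurable hΦ_bdd hη
  have key : Filter.Tendsto (fun n => ∫ Y, (∫ W : (Fin N → Euc d) × (Fin N → Euc d),
      Φ W.1 * bdpKernel d N ρ (chiE d χ (u n)) (W, Y)) ∂P) Filter.atTop (nhds (∫ Y, Φ Y ∂P)) := by
    refine tendsto_integral_filter_of_dominated_convergence (fun _ => 3 * M) ?_ ?_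
      (integrable_const _) ?_
    · filter_upwards [hupos] with n hn
      exact (integral_mul_integral_bdpKernel hρ_nonneg hρ_meas (hgm _) (hmass _ hn)
        hΦ_cont.measurable hΦ_bdd).1.aestronglyMeasurable
    · filter_upwards [hupos] with n hn
      filter_upwards [hmass _ hn] with Y hY
      have h1 := hclose _ hn Y hY (2 * M) fun X _ =>
        (abs_sub _ _).trans (by linarith [hΦ_bdd X, hΦ_bdd Y])
      rw [Real.norm_eq_abs]
      have h2 := hΦ_bdd Y
      rw [abs_le] at *
      constructor <;> linarith
    · filter_upwards [hmass'] with Y hY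
      rw [Metric.tendsto_nhds]
      intro η hη
      obtain ⟨δ, hδ, hδ'⟩ := Metric.continuous_iff.mp hΦ_cont Y (η / 2) (half_pos hη)
      filter_upwards [hupos, hu0.eventually_lt_const (half_pos hδ)] with n hn hnδ
      refine (hclose _ hn Y (hY n hn) (η / 2) fun X hX => ?_).trans_lt (half_lt_self hη)
      exact (hδ' X (by linarith)).le
  refine key.congr' ?_
  filter_upwards [hupos] with n hn
  exact (integral_mul_integral_bdpKernel hρ_nonneg hρ_meas (hgm _) (hmass _ hn)
    hΦ_cont.measurable hΦ_bdd).2.symm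
end
end
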